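/- arXiv:gr-qc/0112061 — 6 statements merged into one kernel-verified Lean document; each statement's English description precedes it below -/
import Mathlib

section
/- Let u0, v0 ∈ ℝ and let Q1, Q2, Q3, Q4 denote the four open quadrants into which the lines {u = u0} and {v = v0} divide ℝ². Let φ : ℝ² → ℝ be continuous, continuously differentiable on each open quadrant, and suppose that the partial derivative ∂φ/∂u extends continuously to the closure of each quadrant. Then: (i) for every u ≠ u0, the values at (u, v0) of the continuous extensions of ∂φ/∂u from the quadrant above the line v = v0 and from the quadrant below it coincide (i.e. ∂φ/∂u has no jump across the line v = v0); and (ii) the jump of ∂φ/∂u across the line u = u0, namely Δ(v) := (continuous extension of ∂φ/∂u from the quadrants with u > u0 evaluated at (u0, v)) − (continuous extension from the quadrants with u < u0 evaluated at (u0, v)), defined separately for v > v0 and v < v0, extends to a continuous function of v on all of ℝ; in particular its one-sided limits as v → v0⁺ and v → v0⁻ agree. -/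
open Set Metric in
/-- If `∂φ/∂u` tends to `L` at `(u₁, v₀)` along `U ×ˢ V`, then `φ(·, v₀)` has difference quotients
close to `L` on `U` near `u₁`. -/
theorem exists_forall_abs_sub_sub_mul_le {U V : Set ℝ} (hU : Convex ℝ U) {φ : ℝ × ℝ → ℝ}
    (hφ : Continuous φ) {u₁ v₀ : ℝ} (hv₀ : v₀ ∈ closure V)
    (hd : ∀ p ∈ U ×ˢ V, DifferentiableAt ℝ φ p) {L : ℝ}
    (hL : Filter.Tendsto (fun p => fderiv ℝ φ p (1, 0)) (nhdsWithin (u₁, v₀) (U ×ˢ V)) (nhds L))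
    {ε : ℝ} (hε : 0 < ε) :
    ∃ δ > 0, ∀ a ∈ U ∩ ball u₁ δ, ∀ b ∈ U ∩ ball u₁ δ,
      |φ (b, v₀) - φ (a, v₀) - L * (b - a)| ≤ ε * |b - a| := by
  obtain ⟨δ, hδ, h⟩ := Metric.tendsto_nhdsWithin_nhds.1 hL ε hε
  refine ⟨δ, hδ, fun a ha b hb => ?_⟩
  have key : ∀ v ∈ ball v₀ δ ∩ V, |φ (b, v) - φ (a, v) - L * (b - a)| ≤ ε * |b - a| := by
    intro v hv
    have hder : ∀ u ∈ U ∩ ball u₁ δ, HasDerivWithinAt (fun u => φ (u, v) - L * u)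
        (fderiv ℝ φ (u, v) (1, 0) - L) (U ∩ ball u₁ δ) u := by
      intro u hu
      have h₁ : HasDerivAt (fun u : ℝ => (u, v)) ((1 : ℝ), (0 : ℝ)) u :=
        (hasDerivAt_id u).prodMk (hasDerivAt_const u v)
      have h₂ := (hd (u, v) ⟨hu.1, hv.2⟩).hasFDerivAt.comp_hasDerivAt u h₁
      have h₃ : HasDerivAt (fun u : ℝ => L * u) L u := by
        simpa using (hasDerivAt_id u).const_mul L
      exact (h₂.sub h₃).hasDerivWithinAt
    have hbound : ∀ u ∈ U ∩ ball u₁ δ, ‖fderiv ℝ φ (u, v) (1, 0) - L‖ ≤ ε := by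
      intro u hu
      have := h (x := (u, v)) ⟨hu.1, hv.2⟩ (by
        rw [Prod.dist_eq]
        exact max_lt hu.2 hv.1)
      rw [Real.dist_eq] at this
      exact this.le
    have := (hU.inter (convex_ball u₁ δ)).norm_image_sub_le_of_norm_hasDerivWithin_le
      hder hbound ha hb
    simp only [Real.norm_eq_abs] at this
    convert this using 2
    ring
  have hcl : v₀ ∈ closure (ball v₀ δ ∩ V) :=
    isOpen_ball.inter_closure ⟨mem_ball_self hδ, hv₀⟩
  have hclosed : IsClosed {v | |φ (b, v) - φ (a, v) - L * (b - a)| ≤ ε * |b - a|} :=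
    isClosed_le (by fun_prop) continuous_const
  exact closure_minimal key hclosed hcl

open Set Metric in
/-- The limits of `∂φ/∂u` at `(u₁, v₀)` along two strips `U ×ˢ V` and `U ×ˢ W` agree. -/
theorem eq_of_tendsto_fderiv_fst {U V W : Set ℝ} (hU : Convex ℝ U) (hUo : IsOpen U)
    {φ : ℝ × ℝ → ℝ} (hφ : Continuous φ) {u₁ v₀ : ℝ} (hu₁ : u₁ ∈ closure U)
    (hV : v₀ ∈ closure V) (hW : v₀ ∈ closure W)
    (hdV : ∀ p ∈ U ×ˢ V, DifferentiableAt ℝ φ p) (hdW : ∀ p ∈ U ×ˢ W, DifferentiableAt ℝ φ p)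
    {L M : ℝ}
    (hL : Filter.Tendsto (fun p => fderiv ℝ φ p (1, 0)) (nhdsWithin (u₁, v₀) (U ×ˢ V)) (nhds L))
    (hM : Filter.Tendsto (fun p => fderiv ℝ φ p (1, 0)) (nhdsWithin (u₁, v₀) (U ×ˢ W)) (nhds M)) :
    L = M := by
  refine eq_of_abs_sub_le_all fun ε hε => ?_
  obtain ⟨δ, hδ, h⟩ := exists_forall_abs_sub_sub_mul_le hU hφ hV hdV hL (half_pos hε)
  obtain ⟨η, hη, k⟩ := exists_forall_abs_sub_sub_mul_le hU hφ hW hdW hM (half_pos hε)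
  obtain ⟨a, ha⟩ : (ball u₁ (min δ η) ∩ U).Nonempty :=
    mem_closure_iff.1 hu₁ _ isOpen_ball (mem_ball_self (lt_min hδ hη))
  obtain ⟨b, hb, hab⟩ : ∃ b ∈ ball u₁ (min δ η) ∩ U, b ≠ a := by
    have hnt := ((isOpen_ball.inter hUo).mem_nhds ha)
    exact ((infinite_of_mem_nhds a hnt).nontrivial).exists_ne a
  have hδ' := ball_subset_ball (x := u₁) (min_le_left δ η)
  have hη' := ball_subset_ball (x := u₁) (min_le_right δ η)
  have h₁ := h a ⟨ha.2, hδ' ha.1⟩ b ⟨hb.2, hδ' hb.1⟩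
  have h₂ := k a ⟨ha.2, hη' ha.1⟩ b ⟨hb.2, hη' hb.1⟩
  have hpos : 0 < |b - a| := abs_pos.2 (sub_ne_zero.2 hab)
  refine le_of_mul_le_mul_right ?_ hpos
  rw [← abs_mul]
  calc |(L - M) * (b - a)|
      = |(φ (b, v₀) - φ (a, v₀) - M * (b - a)) - (φ (b, v₀) - φ (a, v₀) - L * (b - a))| := by
        congr 1; ring
    _ ≤ _ := abs_sub _ _
    _ ≤ ε * |b - a| := by linarith

open Set in
/-- A function continuous on a set containing `S` and equal to `∂φ/∂u` on `S` gives the limit of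
`∂φ/∂u` along `S`. -/
theorem ContinuousOn.tendsto_fderiv_fst {φ g : ℝ × ℝ → ℝ} {S T : Set (ℝ × ℝ)}
    (hg : ContinuousOn g T) (hST : S ⊆ T) (h : ∀ p ∈ S, g p = fderiv ℝ φ p (1, 0))
    {p : ℝ × ℝ} (hp : p ∈ T) :
    Filter.Tendsto (fun p => fderiv ℝ φ p (1, 0)) (nhdsWithin p S) (nhds (g p)) :=
  ((hg p hp).mono hST).tendsto.congr' (eventually_nhdsWithin_of_forall h)


/- STATEMENT 0: Lemma 1 of the paper. A continuous function `φ` on the plane,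
C¹ on each of the four open quadrants determined by the lines `u = u0`, `v = v0`,
whose `u`-partial derivative extends continuously to the closure of each quadrant
(extensions `gpp`, `gpm`, `gmp`, `gmm`), has: (i) no jump of `∂φ/∂u` across the
line `v = v0`; (ii) a jump `Δ` of `∂φ/∂u` across `u = u0` that extends to a
continuous function of `v` on all of `ℝ`. -/
theorem stmt_0 (u0 v0 : ℝ) (φ : ℝ × ℝ → ℝ)
    (hφ : Continuous φ)
    (hφC1 : ∀ p : ℝ × ℝ, p.1 ≠ u0 → p.2 ≠ v0 → ContDiffAt ℝ 1 φ p)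
    (gpp gpm gmp gmm : ℝ × ℝ → ℝ)
    (hgppc : ContinuousOn gpp {p : ℝ × ℝ | u0 ≤ p.1 ∧ v0 ≤ p.2})
    (hgpmc : ContinuousOn gpm {p : ℝ × ℝ | u0 ≤ p.1 ∧ p.2 ≤ v0})
    (hgmpc : ContinuousOn gmp {p : ℝ × ℝ | p.1 ≤ u0 ∧ v0 ≤ p.2})
    (hgmmc : ContinuousOn gmm {p : ℝ × ℝ | p.1 ≤ u0 ∧ p.2 ≤ v0})
    (hgpp : ∀ p : ℝ × ℝ, u0 < p.1 → v0 < p.2 → gpp p = fderiv ℝ φ p (1, 0))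
    (hgpm : ∀ p : ℝ × ℝ, u0 < p.1 → p.2 < v0 → gpm p = fderiv ℝ φ p (1, 0))
    (hgmp : ∀ p : ℝ × ℝ, p.1 < u0 → v0 < p.2 → gmp p = fderiv ℝ φ p (1, 0))
    (hgmm : ∀ p : ℝ × ℝ, p.1 < u0 → p.2 < v0 → gmm p = fderiv ℝ φ p (1, 0)) :
    ((∀ u : ℝ, u0 < u → gpp (u, v0) = gpm (u, v0)) ∧
     (∀ u : ℝ, u < u0 → gmp (u, v0) = gmm (u, v0))) ∧
    ∃ Δ : ℝ → ℝ, Continuous Δ ∧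
      (∀ v : ℝ, v0 ≤ v → Δ v = gpp (u0, v) - gmp (u0, v)) ∧
      (∀ v : ℝ, v ≤ v0 → Δ v = gpm (u0, v) - gmm (u0, v)) := by
  have hR : ∀ u, u0 ≤ u → gpp (u, v0) = gpm (u, v0) := fun u hu =>
    eq_of_tendsto_fderiv_fst (U := Set.Ioi u0) (V := Set.Ioi v0) (W := Set.Iio v0)
      (convex_Ioi u0) isOpen_Ioi hφ (by simpa using hu) (by simp) (by simp)
      (fun p hp => (hφC1 p (ne_of_gt hp.1) (ne_of_gt hp.2)).differentiableAt one_ne_zero)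
      (fun p hp => (hφC1 p (ne_of_gt hp.1) (ne_of_lt hp.2)).differentiableAt one_ne_zero)
      (hgppc.tendsto_fderiv_fst (fun p hp => ⟨le_of_lt hp.1, le_of_lt hp.2⟩)
        (fun p hp => hgpp p hp.1 hp.2) ⟨hu, le_rfl⟩)
      (hgpmc.tendsto_fderiv_fst (fun p hp => ⟨le_of_lt hp.1, le_of_lt hp.2⟩)
        (fun p hp => hgpm p hp.1 hp.2) ⟨hu, le_rfl⟩)
  have hL : ∀ u, u ≤ u0 → gmp (u, v0) = gmm (u, v0) := fun u hu =>
    eq_of_tendsto_fderiv_fst (U := Set.Iio u0) (V := Set.Ioi v0) (W := Set.Iio v0)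
      (convex_Iio u0) isOpen_Iio hφ (by simpa using hu) (by simp) (by simp)
      (fun p hp => (hφC1 p (ne_of_lt hp.1) (ne_of_gt hp.2)).differentiableAt one_ne_zero)
      (fun p hp => (hφC1 p (ne_of_lt hp.1) (ne_of_lt hp.2)).differentiableAt one_ne_zero)
      (hgmpc.tendsto_fderiv_fst (fun p hp => ⟨le_of_lt hp.1, le_of_lt hp.2⟩)
        (fun p hp => hgmp p hp.1 hp.2) ⟨hu, le_rfl⟩)
      (hgmmc.tendsto_fderiv_fst (fun p hp => ⟨le_of_lt hp.1, le_of_lt hp.2⟩)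
        (fun p hp => hgmm p hp.1 hp.2) ⟨hu, le_rfl⟩)
  refine ⟨⟨fun u hu => hR u hu.le, fun u hu => hL u hu.le⟩,
    fun v => if v0 ≤ v then gpp (u0, v) - gmp (u0, v) else gpm (u0, v) - gmm (u0, v),
    ?_, fun v hv => if_pos hv, fun v hv => ?_⟩
  · have hline {s : Set ℝ} : ContinuousOn (fun v : ℝ => (u0, v)) s := by fun_prop
    refine continuous_if_le continuous_const continuous_id ?_ ?_ ?_
    · exact (hgppc.comp hline fun v hv => ⟨le_rfl, hv⟩).sub
        (hgmpc.comp hline fun v hv => ⟨le_rfl, hv⟩)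
    · exact (hgpmc.comp hline fun v hv => ⟨le_rfl, hv⟩).sub
        (hgmmc.comp hline fun v hv => ⟨le_rfl, hv⟩)
    · rintro v rfl
      rw [hR u0 le_rfl, hL u0 le_rfl]
  · rcases hv.eq_or_lt with rfl | hv
    · simp [hR u0 le_rfl, hL u0 le_rfl]
    · exact if_neg hv.not_ge
end

section
/- Let U, V : ℝ² → ℝ (arguments (τ, ρ), dot = ∂/∂τ, prime = ∂/∂ρ) be C² functions satisfying U' < 0, V' > 0 and U̇V' − V̇U' ≠ 0 everywhere. Let A : ℝ² → ℝ be a smooth positive function and R : ℝ² → ℝ a smooth function of (U, V). Define Λ := √(−A(U,V)U'V'), 𝒩 := −((U̇V' − V̇U')/(2U'V'))Λ, 𝒩^ρ := (U̇V' + V̇U')/(2U'V'), r(τ,ρ) := R(U(τ,ρ),V(τ,ρ)), and P_R := −(Λ/𝒩)(ṙ − 𝒩^ρ r') − (r/𝒩)(Λ̇ − (𝒩^ρ Λ)'). Then, writing R_U, R_V, A_U, A_V for the partial derivatives of R and A evaluated at (U(τ,ρ), V(τ,ρ)), one has P_R = R_U U' − R_V V' + (r A_U/(2A)) U' − (r A_V/(2A))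 V' + r U''/(2U') − r V''/(2V'). -/
noncomputable section

/-- The directional derivative of a composite `F (U, V)` by the chain rule. -/
theorem fderiv_comp_pair_apply {F U V : ℝ × ℝ → ℝ} {p : ℝ × ℝ}
    (hF : DifferentiableAt ℝ F (U p, V p)) (hU : DifferentiableAt ℝ U p)
    (hV : DifferentiableAt ℝ V p) (w : ℝ × ℝ) :
    fderiv ℝ (fun q => F (U q, V q)) p w =
      fderiv ℝ F (U p, V p) (1, 0) * fderiv ℝ U p w
        + fderiv ℝ F (U p, V p) (0, 1) * fderiv ℝ V p w := by
  have h := HasFDerivAt.comp (g := F) p hF.hasFDerivAt (hU.hasFDerivAt.prodMk hV.hasFDerivAt)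
  have h' : fderiv ℝ (fun q => F (U q, V q)) p = _ := h.fderiv
  have hw : (fderiv ℝ U p w, fderiv ℝ V p w)
      = fderiv ℝ U p w • ((1, 0) : ℝ × ℝ) + fderiv ℝ V p w • ((0, 1) : ℝ × ℝ) := by
    ext <;> simp
  rw [h', ContinuousLinearMap.comp_apply, ContinuousLinearMap.prod_apply, hw, map_add,
    map_smul, map_smul, smul_eq_mul, smul_eq_mul]
  ring

/-- The directional derivatives of a `C²` function are differentiable. -/
theorem differentiable_fderiv_apply {U : ℝ × ℝ → ℝ} (hU : ContDiff ℝ 2 U) (w : ℝ × ℝ) :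
    Differentiable ℝ (fun q => fderiv ℝ U q w) :=
  ((hU.fderiv_right (m := 1) (by norm_num)).differentiable (by norm_num)).clm_apply
    (differentiable_const w)

/-- Mixed directional derivatives of a `C²` function commute. -/
theorem fderiv_fderiv_apply_comm {U : ℝ × ℝ → ℝ} (hU : ContDiff ℝ 2 U) (p w z : ℝ × ℝ) :
    fderiv ℝ (fun q => fderiv ℝ U q w) p z = fderiv ℝ (fun q => fderiv ℝ U q z) p w := by
  have hd : DifferentiableAt ℝ (fderiv ℝ U) p :=
    (hU.fderiv_right (m := 1) (by norm_num)).differentiable (by norm_num) p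
  have key (x y : ℝ × ℝ) :
      fderiv ℝ (fun q => fderiv ℝ U q x) p y = fderiv ℝ (fderiv ℝ U) p y x := by
    rw [fderiv_clm_apply hd (differentiableAt_const x)]
    simp
  rw [key, key]
  exact (hU.contDiffAt.isSymmSndFDerivAt (by simp)) z w

/- STATEMENT 2: With `U, V` a C² double-null foliation (arguments `(τ, ρ)`;
dot = derivative in direction `(1,0)`, prime = direction `(0,1)`) satisfying
`U' < 0`, `V' > 0`, `U̇V' − V̇U' ≠ 0`, with `A > 0` and `R` smooth functions of
`(U, V)`, and with `Λ`, `𝒩`, `𝒩ρ`, `r`, `P_R` defined as in the canonical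
formalism, one has
`P_R = R_U U' − R_V V' + (r A_U/(2A)) U' − (r A_V/(2A)) V' + r U''/(2U') − r V''/(2V')`. -/
theorem stmt_2 (U V : ℝ × ℝ → ℝ) (A R : ℝ × ℝ → ℝ)
    (hU : ContDiff ℝ 2 U) (hV : ContDiff ℝ 2 V)
    (hA : ContDiff ℝ (⊤ : ℕ∞) A) (hR : ContDiff ℝ (⊤ : ℕ∞) R)
    (hApos : ∀ q : ℝ × ℝ, 0 < A q)
    (hU' : ∀ p : ℝ × ℝ, fderiv ℝ U p (0, 1) < 0)
    (hV' : ∀ p : ℝ × ℝ, 0 < fderiv ℝ V p (0, 1))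
    (hdet : ∀ p : ℝ × ℝ,
      fderiv ℝ U p (1, 0) * fderiv ℝ V p (0, 1)
        - fderiv ℝ V p (1, 0) * fderiv ℝ U p (0, 1) ≠ 0)
    (Λ 𝒩 𝒩ρ r PR : ℝ × ℝ → ℝ)
    (hΛ : ∀ p, Λ p =
      Real.sqrt (-(A (U p, V p)) * fderiv ℝ U p (0, 1) * fderiv ℝ V p (0, 1)))
    (h𝒩 : ∀ p, 𝒩 p =
      -((fderiv ℝ U p (1, 0) * fderiv ℝ V p (0, 1)
          - fderiv ℝ V p (1, 0) * fderiv ℝ U p (0, 1))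
        / (2 * fderiv ℝ U p (0, 1) * fderiv ℝ V p (0, 1))) * Λ p)
    (h𝒩ρ : ∀ p, 𝒩ρ p =
      (fderiv ℝ U p (1, 0) * fderiv ℝ V p (0, 1)
          + fderiv ℝ V p (1, 0) * fderiv ℝ U p (0, 1))
        / (2 * fderiv ℝ U p (0, 1) * fderiv ℝ V p (0, 1)))
    (hr : ∀ p, r p = R (U p, V p))
    (hPR : ∀ p, PR p =
      -(Λ p / 𝒩 p) * (fderiv ℝ r p (1, 0) - 𝒩ρ p * fderiv ℝ r p (0, 1))
      - (r p / 𝒩 p) * (fderiv ℝ Λ p (1, 0)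
          - fderiv ℝ (fun q => 𝒩ρ q * Λ q) p (0, 1))) :
    ∀ p : ℝ × ℝ, PR p =
      fderiv ℝ R (U p, V p) (1, 0) * fderiv ℝ U p (0, 1)
      - fderiv ℝ R (U p, V p) (0, 1) * fderiv ℝ V p (0, 1)
      + r p * fderiv ℝ A (U p, V p) (1, 0) / (2 * A (U p, V p)) * fderiv ℝ U p (0, 1)
      - r p * fderiv ℝ A (U p, V p) (0, 1) / (2 * A (U p, V p)) * fderiv ℝ V p (0, 1)
      + r p * fderiv ℝ (fun q => fderiv ℝ U q (0, 1)) p (0, 1) / (2 * fderiv ℝ U p (0, 1))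
      - r p * fderiv ℝ (fun q => fderiv ℝ V q (0, 1)) p (0, 1) / (2 * fderiv ℝ V p (0, 1)) := by
  intro p
  have hUd : Differentiable ℝ U := hU.differentiable (by norm_num)
  have hVd : Differentiable ℝ V := hV.differentiable (by norm_num)
  have hAd : Differentiable ℝ A := hA.differentiable (by simp)
  have hRd : Differentiable ℝ R := hR.differentiable (by simp)
  have hau := differentiable_fderiv_apply hU (1, 0)
  have hu := differentiable_fderiv_apply hU (0, 1)
  have hbv := differentiable_fderiv_apply hV (1, 0)
  have hv := differentiable_fderiv_apply hV (0, 1)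
  have hAc : Differentiable ℝ (fun q => A (U q, V q)) := hAd.comp (hUd.prodMk hVd)
  have hpos (q : ℝ × ℝ) :
      0 < -(A (U q, V q)) * fderiv ℝ U q (0, 1) * fderiv ℝ V q (0, 1) :=
    mul_pos (mul_pos_of_neg_of_neg (neg_lt_zero.2 (hApos _)) (hU' q)) (hV' q)
  have hΛpos : 0 < Λ p := by rw [hΛ]; exact Real.sqrt_pos.2 (hpos p)
  have hΛd : Differentiable ℝ Λ := by
    rw [funext hΛ]
    exact ((hAc.neg.mul hu).mul hv).sqrt fun q => (hpos q).ne'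
  have hnd : Differentiable ℝ 𝒩ρ := by
    rw [funext h𝒩ρ]
    exact ((hau.mul hv).add (hbv.mul hu)).mul (((hu.const_mul 2).mul hv).inv fun q =>
      mul_ne_zero (mul_ne_zero two_ne_zero (hU' q).ne) (hV' q).ne')
  have hΛsq : (fun q => Λ q * Λ q) = fun q =>
      -(A (U q, V q)) * fderiv ℝ U q (0, 1) * fderiv ℝ V q (0, 1) := by
    funext q
    rw [hΛ]
    exact Real.mul_self_sqrt (hpos q).le
  have hnmul : (fun q => 𝒩ρ q * (fderiv ℝ U q (0, 1) * fderiv ℝ V q (0, 1))) = fun q =>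
      (1 / 2 : ℝ) * (fderiv ℝ U q (1, 0) * fderiv ℝ V q (0, 1)
        + fderiv ℝ V q (1, 0) * fderiv ℝ U q (0, 1)) := by
    funext q
    have h1 := (hU' q).ne
    have h2 := (hV' q).ne'
    rw [h𝒩ρ]
    field_simp
  have dΛ (w : ℝ × ℝ) : 2 * Λ p * fderiv ℝ Λ p w =
      -((fderiv ℝ A (U p, V p) (1, 0) * fderiv ℝ U p w
        + fderiv ℝ A (U p, V p) (0, 1) * fderiv ℝ V p w)
          * fderiv ℝ U p (0, 1) * fderiv ℝ V p (0, 1)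
      + A (U p, V p) * fderiv ℝ (fun q => fderiv ℝ U q (0, 1)) p w * fderiv ℝ V p (0, 1)
      + A (U p, V p) * fderiv ℝ U p (0, 1) * fderiv ℝ (fun q => fderiv ℝ V q (0, 1)) p w) := by
    have h := congrArg (fun f => fderiv ℝ f p w) hΛsq
    have h1 := ((hΛd p).hasFDerivAt.mul (hΛd p).hasFDerivAt).fderiv
    have h2 := (((hAc p).hasFDerivAt.neg.mul (hu p).hasFDerivAt).mul (hv p).hasFDerivAt).fderiv
    have h3 := fderiv_comp_pair_apply (hAd _) (hUd p) (hVd p) w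
    rw [← h3]
    have h1' := congrArg (fun L => L w) h1
    have h2' := congrArg (fun L => L w) h2
    have h4 := h1'.symm.trans (h.trans h2')
    simp only [add_apply, smul_apply, smul_eq_mul,
      neg_apply, Pi.neg_apply, Pi.mul_apply] at h4
    linear_combination h4
  have dn : fderiv ℝ 𝒩ρ p (0, 1) * (fderiv ℝ U p (0, 1) * fderiv ℝ V p (0, 1))
      + 𝒩ρ p * (fderiv ℝ (fun q => fderiv ℝ U q (0, 1)) p (0, 1) * fderiv ℝ V p (0, 1)
        + fderiv ℝ U p (0, 1) * fderiv ℝ (fun q => fderiv ℝ V q (0, 1)) p (0, 1))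
      = (1 / 2) * (fderiv ℝ (fun q => fderiv ℝ U q (0, 1)) p (1, 0) * fderiv ℝ V p (0, 1)
        + fderiv ℝ U p (1, 0) * fderiv ℝ (fun q => fderiv ℝ V q (0, 1)) p (0, 1)
        + fderiv ℝ (fun q => fderiv ℝ V q (0, 1)) p (1, 0) * fderiv ℝ U p (0, 1)
        + fderiv ℝ V p (1, 0) * fderiv ℝ (fun q => fderiv ℝ U q (0, 1)) p (0, 1)) := by
    have h := congrArg (fun f => fderiv ℝ f p (0, 1)) hnmul
    have h1 := ((hnd p).hasFDerivAt.mul ((hu p).hasFDerivAt.mul (hv p).hasFDerivAt)).fderiv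
    have h2 := ((((hau p).hasFDerivAt.mul (hv p).hasFDerivAt).add
      ((hbv p).hasFDerivAt.mul (hu p).hasFDerivAt)).const_mul (1 / 2 : ℝ)).fderiv
    have h1' := congrArg (fun L => L ((0, 1) : ℝ × ℝ)) h1
    have h2' := congrArg (fun L => L ((0, 1) : ℝ × ℝ)) h2
    have h4 := h1'.symm.trans (h.trans h2')
    simp only [add_apply, smul_apply, smul_eq_mul,
      Pi.mul_apply] at h4
    rw [fderiv_fderiv_apply_comm hU p (1, 0), fderiv_fderiv_apply_comm hV p (1, 0)] at h4
    linear_combination h4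
  have dnΛ : fderiv ℝ (fun q => 𝒩ρ q * Λ q) p (0, 1)
      = 𝒩ρ p * fderiv ℝ Λ p (0, 1) + Λ p * fderiv ℝ 𝒩ρ p (0, 1) :=
    congrArg (fun L => L ((0, 1) : ℝ × ℝ)) ((hnd p).hasFDerivAt.mul (hΛd p).hasFDerivAt).fderiv
  have dr (w : ℝ × ℝ) : fderiv ℝ r p w =
      fderiv ℝ R (U p, V p) (1, 0) * fderiv ℝ U p w
        + fderiv ℝ R (U p, V p) (0, 1) * fderiv ℝ V p w := by
    rw [funext hr]
    exact fderiv_comp_pair_apply (hRd _) (hUd p) (hVd p) w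
  have hΛp := congrFun hΛsq p
  have dΛ0 := dΛ (1, 0)
  have dΛ1 := dΛ (0, 1)
  have hnp := h𝒩ρ p
  rw [hPR, dnΛ, dr, dr, h𝒩 p]
  have hAp := hApos (U p, V p)
  have hup := hU' p
  have hvp := hV' p
  have hDp := hdet p
  clear dΛ dr dnΛ hnmul hPR h𝒩 h𝒩ρ
  generalize fderiv ℝ (fun q => fderiv ℝ U q (0, 1)) p (0, 1) = u1 at *
  generalize fderiv ℝ (fun q => fderiv ℝ V q (0, 1)) p (0, 1) = v1 at *
  generalize fderiv ℝ (fun q => fderiv ℝ U q (0, 1)) p (1, 0) = u0 at *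
  generalize fderiv ℝ (fun q => fderiv ℝ V q (0, 1)) p (1, 0) = v0 at *
  generalize fderiv ℝ A (U p, V p) (1, 0) = AU at *
  generalize fderiv ℝ A (U p, V p) (0, 1) = AV at *
  generalize fderiv ℝ R (U p, V p) (1, 0) = RU at *
  generalize fderiv ℝ R (U p, V p) (0, 1) = RV at *
  generalize fderiv ℝ 𝒩ρ p (0, 1) = n1 at *
  generalize fderiv ℝ Λ p (0, 1) = L1 at *
  generalize fderiv ℝ Λ p (1, 0) = L0 at *
  generalize A (U p, V p) = a at *
  generalize fderiv ℝ U p (0, 1) = u at *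
  generalize fderiv ℝ V p (0, 1) = v at *
  generalize fderiv ℝ U p (1, 0) = x at *
  generalize fderiv ℝ V p (1, 0) = y at *
  generalize Λ p = L at *
  generalize 𝒩ρ p = n at *
  generalize r p = s at *
  have hu0 := hup.ne
  have hv0 := hvp.ne'
  have ha0 := hAp.ne'
  have hL0 := hΛpos.ne'
  have e (M : ℝ) : 2 * L * M = 2 * (L * L) * (M / L) := by field_simp
  rw [e, hΛp] at dΛ0 dΛ1
  have hc : 2 * (-a * u * v) ≠ 0 :=
    mul_ne_zero two_ne_zero (mul_ne_zero (mul_ne_zero (neg_ne_zero.2 ha0) hu0) hv0)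
  have f0 : L0 / L = ((AU * x + AV * y) / a + u0 / u + v0 / v) / 2 := by
    apply mul_left_cancel₀ hc
    rw [dΛ0]
    field_simp
  have f1 : L1 / L = ((AU * u + AV * v) / a + u1 / u + v1 / v) / 2 := by
    apply mul_left_cancel₀ hc
    rw [dΛ1]
    field_simp
  rw [div_eq_iff hL0] at f0 f1
  have fn : n1 = ((u0 * v + x * v1 + v0 * u + y * u1) / 2 - n * (u1 * v + u * v1)) / (u * v) := by
    rw [eq_div_iff (mul_ne_zero hu0 hv0)]
    linear_combination dn
  rw [f0, f1, fn, hnp]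
  field_simp
  ring
end
end

section
/- Fix N ∈ ℕ and write points of ℝ × ℝ × (Fin N → ℝ) as (U, V, o). Let F, G : ℝ × ℝ × (Fin N → ℝ) → ℝ and H_i (i ∈ Fin N) be C² functions satisfying the homogeneous system ∂_V F = ∂_U G, ∂_U H_i = ∂_{o_i} F, ∂_V H_i = ∂_{o_i} G for every i. Then for all i, j ∈ Fin N the function c_{ij} := ∂_{o_j} H_i − ∂_{o_i} H_j satisfies ∂_U c_{ij} = 0 and ∂_V c_{ij} = 0; consequently c_{ij}(U, V, o) = c_{ij}(U', V', o) for all U, V, U', V' ∈ ℝ and all o, i.e. c_{ij} depends only on the variables o. -/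
noncomputable section

/-- Points `(U, V, o)` with `o = (o¹, …, o^N)` the Dirac observables. -/
abbrev Pt (N : ℕ) := ℝ × ℝ × (Fin N → ℝ)

/-- The direction of the coordinate `U`. -/
def dU (N : ℕ) : Pt N := (1, 0, 0)

/-- The direction of the coordinate `V`. -/
def dV (N : ℕ) : Pt N := (0, 1, 0)

/-- The direction of the observable `o^i`. -/
def dO (N : ℕ) (i : Fin N) : Pt N := (0, 0, Pi.single i 1)

/-- Partial derivative of `f` in the direction `d` at `p`. -/
def pd {N : ℕ} (d : Pt N) (f : Pt N → ℝ) (p : Pt N) : ℝ := fderiv ℝ f p d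

theorem differentiable_pd {N : ℕ} {f : Pt N → ℝ} (hf : ContDiff ℝ 2 f) (d : Pt N) :
    Differentiable ℝ (pd d f) :=
  ((hf.fderiv_right (m := 1) (by norm_num)).differentiable (by norm_num)).clm_apply
    (differentiable_const d)

theorem pd_pd {N : ℕ} {f : Pt N → ℝ} (hf : ContDiff ℝ 2 f) (d e p : Pt N) :
    pd d (pd e f) p = fderiv ℝ (fderiv ℝ f) p d e := by
  have h : DifferentiableAt ℝ (fderiv ℝ f) p :=
    (hf.fderiv_right (m := 1) (by norm_num)).differentiable (by norm_num) p
  have h' := (h.hasFDerivAt.clm_apply (hasFDerivAt_const e p)).fderiv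
  change fderiv ℝ (fun q => fderiv ℝ f q e) p d = _
  rw [h']
  simp

theorem pd_comm {N : ℕ} {f : Pt N → ℝ} (hf : ContDiff ℝ 2 f) (d e p : Pt N) :
    pd d (pd e f) p = pd e (pd d f) p := by
  rw [pd_pd hf, pd_pd hf]
  exact hf.contDiffAt.isSymmSndFDerivAt (by simp) d e

/-- If the `d`-derivatives of `h` and `k` are the `a`- and `b`-derivatives of a common
potential, then the curl `∂_b h - ∂_a k` is constant along `d`. -/
theorem pd_curl_eq_zero {N : ℕ} {f h k : Pt N → ℝ} (hf : ContDiff ℝ 2 f)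
    (hh : ContDiff ℝ 2 h) (hk : ContDiff ℝ 2 k) {d a b : Pt N}
    (hha : ∀ p, pd d h p = pd a f p) (hkb : ∀ p, pd d k p = pd b f p) (p : Pt N) :
    pd d (fun q => pd b h q - pd a k q) p = 0 := by
  have hsub : pd d (fun q => pd b h q - pd a k q) p = pd d (pd b h) p - pd d (pd a k) p :=
    congrArg (fun L : Pt N →L[ℝ] ℝ => L d)
      (fderiv_fun_sub (differentiable_pd hh b p) (differentiable_pd hk a p))
  rw [hsub, pd_comm hh, pd_comm hk, funext hha, funext hkb, pd_comm hf, sub_self]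

/-- A differentiable function whose `U`- and `V`-derivatives vanish depends only on `o`. -/
theorem eq_of_pd_dU_dV_eq_zero {N : ℕ} {c : Pt N → ℝ} (hc : Differentiable ℝ c)
    (hU : ∀ p, pd (dU N) c p = 0) (hV : ∀ p, pd (dV N) c p = 0)
    (u v u' v' : ℝ) (o : Fin N → ℝ) : c (u, v, o) = c (u', v', o) := by
  let g : ℝ × ℝ → Pt N := fun x => (x.1, x.2, o)
  have hg (x : ℝ × ℝ) : HasFDerivAt g ((ContinuousLinearMap.fst ℝ ℝ ℝ).prod
      ((ContinuousLinearMap.snd ℝ ℝ ℝ).prod 0)) x :=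
    hasFDerivAt_fst.prodMk (hasFDerivAt_snd.prodMk (hasFDerivAt_const o x))
  have hcg (x : ℝ × ℝ) := (hc (g x)).hasFDerivAt.comp x (hg x)
  refine is_const_of_fderiv_eq_zero (𝕜 := ℝ) (f := c ∘ g)
    (fun x => (hcg x).differentiableAt) (fun x => ?_) (u, v) (u', v')
  rw [(hcg x).fderiv]
  ext
  · simpa [pd, dU] using hU (g x)
  · simpa [pd, dV] using hV (g x)

/- STATEMENT 4: If C² functions `F`, `G`, `H_i` satisfy the homogeneous system
`∂_V F = ∂_U G`, `∂_U H_i = ∂_{o_i} F`, `∂_V H_i = ∂_{o_i} G`, then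
`c_{ij} := ∂_{o_j} H_i − ∂_{o_i} H_j` satisfies `∂_U c_{ij} = 0 = ∂_V c_{ij}`,
hence depends only on the observables `o`. -/
theorem stmt_4 (N : ℕ) (F G : Pt N → ℝ) (H : Fin N → Pt N → ℝ)
    (hF : ContDiff ℝ 2 F) (hG : ContDiff ℝ 2 G) (hH : ∀ i, ContDiff ℝ 2 (H i))
    (h1 : ∀ p, pd (dV N) F p = pd (dU N) G p)
    (h2 : ∀ i, ∀ p, pd (dU N) (H i) p = pd (dO N i) F p)
    (h3 : ∀ i, ∀ p, pd (dV N) (H i) p = pd (dO N i) G p) :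
    ∀ i j : Fin N,
      (∀ p : Pt N,
        pd (dU N) (fun q => pd (dO N j) (H i) q - pd (dO N i) (H j) q) p = 0 ∧
        pd (dV N) (fun q => pd (dO N j) (H i) q - pd (dO N i) (H j) q) p = 0) ∧
      (∀ (u v u' v' : ℝ) (o : Fin N → ℝ),
        pd (dO N j) (H i) (u, v, o) - pd (dO N i) (H j) (u, v, o)
          = pd (dO N j) (H i) (u', v', o) - pd (dO N i) (H j) (u', v', o)) := by
  intro i j
  have hU := pd_curl_eq_zero hF (hH i) (hH j) (h2 i) (h2 j)
  have hV := pd_curl_eq_zero hG (hH i) (hH j) (h3 i) (h3 j)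
  exact ⟨fun p => ⟨hU p, hV p⟩, eq_of_pd_dU_dV_eq_zero
    ((differentiable_pd (hH i) _).sub (differentiable_pd (hH j) _)) hU hV⟩
end
end

section
/- Fix N ∈ ℕ, signs α, β ∈ {−1, 1}, and a smooth function M : (Fin N → ℝ) → (0, ∞). Let Ω ⊆ ℝ × ℝ × (Fin N → ℝ) be open (points written (Ũ, Ṽ, o)) and let R̃ : Ω → (0, ∞) be a smooth function with R̃(Ũ,Ṽ,o) ≠ 2M(o) on Ω, satisfying the implicit Eddington–Finkelstein relation (R̃/(2M(o)) − 1) · exp(R̃/(2M(o))) = αβ · exp( (−αŨ + βṼ)/(4M(o)) ) on Ω. Define Ã := αβ(1 − 2M(o)/R̃). Then the vacuum double-null equations hold on Ω: 4 R̃ ∂_Ũ∂_Ṽ R̃ + 4 (∂_Ũ R̃)(∂_Ṽ R̃) + Ã = 0, Ã ∂_Ũ∂_Ũ R̃ − (∂_Ũ Ã)(∂_Ũ R̃) = 0, and Ã ∂_Ṽ∂_Ṽ R̃ − (∂_Ṽ Ã)(∂_Ṽ R̃) = 0. -/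
noncomputable section

/-- A partial derivative is the derivative along the corresponding line. -/
lemma hasDerivAt_line {N : ℕ} {f : Pt N → ℝ} {p : Pt N} (d : Pt N)
    (hf : DifferentiableAt ℝ f p) :
    HasDerivAt (fun t : ℝ => f (p + t • d)) (pd d f p) 0 :=
  hf.hasFDerivAt.hasLineDerivAt d

/-- The partial derivative of `k (1 - 2M/R)` in a direction that fixes the observables. -/
lemma pd_const_mul_one_sub_div {N : ℕ} {M : (Fin N → ℝ) → ℝ} {R : Pt N → ℝ} {p : Pt N}
    (hM : DifferentiableAt ℝ M p.2.2) (hR : DifferentiableAt ℝ R p) (hp : R p ≠ 0)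
    (d : Pt N) (hd : d.2.2 = 0) (k : ℝ) :
    pd d (fun q => k * (1 - 2 * M q.2.2 / R q)) p
      = k * (2 * M p.2.2 / R p ^ 2) * pd d R p := by
  have hM' : DifferentiableAt ℝ (fun q : Pt N => M q.2.2) p :=
    DifferentiableAt.comp (g := M) (f := fun q : Pt N => q.2.2) p hM (by fun_prop)
  have hF : DifferentiableAt ℝ (fun q : Pt N => k * (1 - 2 * M q.2.2 / R q)) p := by
    fun_prop (disch := assumption)
  have h1 := hasDerivAt_line d hF
  have h2 := hasDerivAt_line d hR
  simp only [Prod.snd_add, Prod.smul_snd, hd, smul_zero, add_zero] at h1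
  have h3 := (((hasDerivAt_const (0 : ℝ) (2 * M p.2.2)).div h2 (by simpa using hp)).const_sub
    1).const_mul k
  rw [h1.unique h3]
  simp only [zero_smul, add_zero]
  ring

/-- Implicit differentiation of the Eddington–Finkelstein relation in a direction that fixes the
observables. -/
lemma pd_radius {N : ℕ} {α β : ℝ} {M : (Fin N → ℝ) → ℝ} {R : Pt N → ℝ} {p : Pt N}
    (hM : 0 < M p.2.2) (hR : DifferentiableAt ℝ R p) (hp : 0 < R p)
    (hrel : ∀ᶠ q in nhds p,
      (R q / (2 * M q.2.2) - 1) * Real.exp (R q / (2 * M q.2.2))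
        = α * β * Real.exp ((-(α * q.1) + β * q.2.1) / (4 * M q.2.2)))
    (d : Pt N) (hd : d.2.2 = 0) :
    pd d R p = (-(α * d.1) + β * d.2.1) / 2 * (1 - 2 * M p.2.2 / R p) := by
  have hline : Filter.Tendsto (fun t : ℝ => p + t • d) (nhds 0) (nhds p) := by
    have : Continuous (fun t : ℝ => p + t • d) := by fun_prop
    simpa using this.tendsto 0
  have hev := hline.eventually hrel
  simp only [Prod.snd_add, Prod.fst_add, Prod.smul_snd, Prod.smul_fst, hd, smul_zero, add_zero,
    smul_eq_mul] at hev
  have h2 := (hasDerivAt_line d hR).div_const (2 * M p.2.2)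
  have hl := (h2.sub_const 1).mul h2.exp
  have hw : HasDerivAt (fun t : ℝ => (-(α * (p.1 + t * d.1)) + β * (p.2.1 + t * d.2.1))
      / (4 * M p.2.2)) ((-(α * d.1) + β * d.2.1) / (4 * M p.2.2)) 0 := by
    have h (x y : ℝ) : HasDerivAt (fun t : ℝ => x + t * y) y 0 := by
      simpa using ((hasDerivAt_id (0 : ℝ)).mul_const y).const_add x
    simpa using ((((h p.1 d.1).const_mul α).neg).add ((h p.2.1 d.2.1).const_mul β)).div_const
      (4 * M p.2.2)
  have hr := hw.exp.const_mul (α * β)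
  have key := hl.unique (hr.congr_of_eventuallyEq hev)
  have hp0 := hrel.self_of_nhds
  simp only [zero_smul, add_zero, zero_mul] at key
  rw [← mul_assoc (α * β), ← hp0] at key
  have hE := Real.exp_pos (R p / (2 * M p.2.2))
  generalize Real.exp (R p / (2 * M p.2.2)) = E at key hE
  have hE' := hE.ne'
  have hM' := hM.ne'
  have hp' := hp.ne'
  have key' : R p / (2 * M p.2.2) * (pd d R p / (2 * M p.2.2))
      = (R p / (2 * M p.2.2) - 1) * ((-(α * d.1) + β * d.2.1) / (4 * M p.2.2)) := by
    apply mul_left_cancel₀ hE'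
    linear_combination key
  field_simp at key' ⊢
  linear_combination key' / 2

/- STATEMENT 9: The Schwarzschild radius function `R̃` of the `(αβ)`-quadrant of
the Schwarzschild spacetime of mass `M(o)` in double-null Eddington–Finkelstein
coordinates, defined implicitly by
`(R̃/(2M) − 1) e^{R̃/(2M)} = αβ e^{(−αŨ + βṼ)/(4M)}`, together with
`Ã = αβ(1 − 2M/R̃)`, satisfies the vacuum double-null Einstein equations on `Ω`. -/
theorem stmt_9 (N : ℕ) (α β : ℝ) (hα : α = 1 ∨ α = -1) (hβ : β = 1 ∨ β = -1)
    (M : (Fin N → ℝ) → ℝ) (hM : ContDiff ℝ (⊤ : ℕ∞) M) (hMpos : ∀ o, 0 < M o)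
    (Ω : Set (Pt N)) (hΩ : IsOpen Ω)
    (Rt : Pt N → ℝ) (hRt : ContDiffOn ℝ (⊤ : ℕ∞) Rt Ω)
    (hRpos : ∀ p ∈ Ω, 0 < Rt p)
    (hRhor : ∀ p ∈ Ω, Rt p ≠ 2 * M p.2.2)
    (hrel : ∀ p ∈ Ω,
      (Rt p / (2 * M p.2.2) - 1) * Real.exp (Rt p / (2 * M p.2.2))
        = α * β * Real.exp ((-(α * p.1) + β * p.2.1) / (4 * M p.2.2)))
    (At : Pt N → ℝ)
    (hAdef : ∀ p : Pt N, At p = α * β * (1 - 2 * M p.2.2 / Rt p)) :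
    ∀ p ∈ Ω,
      (4 * Rt p * pd (dU N) (pd (dV N) Rt) p
        + 4 * pd (dU N) Rt p * pd (dV N) Rt p + At p = 0) ∧
      (At p * pd (dU N) (pd (dU N) Rt) p - pd (dU N) At p * pd (dU N) Rt p = 0) ∧
      (At p * pd (dV N) (pd (dV N) Rt) p - pd (dV N) At p * pd (dV N) Rt p = 0) := by
  intro p hp
  have hdiff : ∀ q ∈ Ω, DifferentiableAt ℝ Rt q := fun q hq =>
    (hRt.contDiffAt (hΩ.mem_nhds hq)).differentiableAt (by simp)
  have hMd : DifferentiableAt ℝ M p.2.2 := hM.contDiffAt.differentiableAt (by simp)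
  have hfirst (d : Pt N) (hd : d.2.2 = 0) (q : Pt N) (hq : q ∈ Ω) :
      pd d Rt q = (-(α * d.1) + β * d.2.1) / 2 * (1 - 2 * M q.2.2 / Rt q) :=
    pd_radius (hMpos _) (hdiff q hq) (hRpos q hq)
      (Filter.mem_of_superset (hΩ.mem_nhds hq) hrel) d hd
  have hF := pd_const_mul_one_sub_div hMd (hdiff p hp) (hRpos p hp).ne'
  have hsecond (e d : Pt N) (he : e.2.2 = 0) (hd : d.2.2 = 0) :
      pd e (pd d Rt) p
        = (-(α * d.1) + β * d.2.1) / 2 * (2 * M p.2.2 / Rt p ^ 2) * pd e Rt p := by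
    rw [← hF e he]
    have hev : pd d Rt =ᶠ[nhds p]
        fun q => (-(α * d.1) + β * d.2.1) / 2 * (1 - 2 * M q.2.2 / Rt q) :=
      Filter.mem_of_superset (hΩ.mem_nhds hp) (hfirst d hd)
    unfold pd at hev ⊢
    rw [hev.fderiv_eq]
  have hA (d : Pt N) (hd : d.2.2 = 0) :
      pd d At p = α * β * (2 * M p.2.2 / Rt p ^ 2) * pd d Rt p := by
    rw [← hF d hd, funext hAdef]
  have hU : (dU N).2.2 = 0 := rfl
  have hV : (dV N).2.2 = 0 := rfl
  have hR0 := (hRpos p hp).ne'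
  rw [hsecond _ _ hU hV, hsecond _ _ hU hU, hsecond _ _ hV hV, hA _ hU, hA _ hV,
    hfirst _ hU p hp, hfirst _ hV p hp, hAdef]
  simp only [dU, dV]
  refine ⟨?_, ?_, ?_⟩
  · field_simp
    ring
  · ring
  · ring
end
end

section
/- Fix N ∈ ℕ and a smooth function M : (Fin N → ℝ) → (0, ∞). Let Ω ⊆ ℝ × ℝ × (Fin N → ℝ) be open (points written (U, V, o)) and let R : Ω → (0, ∞) be a smooth function satisfying (R/(2M(o)) − 1) · exp(R/(2M(o))) = −UV on Ω. Define A := (32 M(o)³ / R) · exp(−R/(2M(o))). Then the functions F_reg := −(M(o)(R + 2M(o))/2) · exp(−R/(2M(o))) · V, G_reg := (M(o)(R + 2M(o))/2) · exp(−R/(2M(o))) · U, and H_i := 0 (i ∈ Fin N) solve system (S) for (A, R) on Ω. In particular this solution is regular on all of Ω, including the horizons U = 0 and V = 0. -/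
noncomputable section

/-- System (S) of the paper (Eqs. (6,5)–(6,7)) on a domain `Ω`. -/
def SolvesSOn (N : ℕ) (Ω : Set (Pt N)) (A R F G : Pt N → ℝ)
    (H : Fin N → Pt N → ℝ) : Prop :=
  ∀ (i : Fin N), ∀ p ∈ Ω,
    (pd (dV N) F p - pd (dU N) G p
      = R p / (2 * A p) * (2 * A p * pd (dU N) (pd (dV N) R) p
          - pd (dU N) A p * pd (dV N) R p - pd (dV N) A p * pd (dU N) R p)) ∧
    (pd (dU N) (H i) p - pd (dO N i) F p
      = -(R p / (2 * A p)) * (2 * A p * pd (dO N i) (pd (dU N) R) p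
          - pd (dO N i) A p * pd (dU N) R p - pd (dU N) A p * pd (dO N i) R p)) ∧
    (pd (dV N) (H i) p - pd (dO N i) G p
      = R p / (2 * A p) * (2 * A p * pd (dO N i) (pd (dV N) R) p
          - pd (dO N i) A p * pd (dV N) R p - pd (dV N) A p * pd (dO N i) R p))

section PartialDerivatives

variable {N : ℕ} {d p : Pt N} {f g : Pt N → ℝ}

lemma pd_congr (h : f =ᶠ[nhds p] g) : pd d f p = pd d g p := by
  rw [pd, pd, h.fderiv_eq]

lemma pd_mul (hf : DifferentiableAt ℝ f p) (hg : DifferentiableAt ℝ g p) :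
    pd d (fun q => f q * g q) p = pd d f p * g p + f p * pd d g p := by
  simp only [pd]
  rw [(hf.hasFDerivAt.fun_mul hg.hasFDerivAt).fderiv]
  simp
  ring

lemma pd_const_mul (c : ℝ) (hf : DifferentiableAt ℝ f p) :
    pd d (fun q => c * f q) p = c * pd d f p := by
  simp only [pd]
  rw [(hf.hasFDerivAt.const_mul c).fderiv]
  simp

lemma pd_add_const (c : ℝ) : pd d (fun q => f q + c) p = pd d f p := by
  simp only [pd, fderiv_add_const]

lemma pd_exp (hf : DifferentiableAt ℝ f p) :
    pd d (fun q => Real.exp (f q)) p = Real.exp (f p) * pd d f p := by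
  simp only [pd]
  rw [hf.hasFDerivAt.exp.fderiv]
  simp

lemma pd_neg : pd d (fun q => -f q) p = -pd d f p := by
  simp only [pd, fderiv_fun_neg]
  simp

lemma pd_div (hf : DifferentiableAt ℝ f p) (hg : DifferentiableAt ℝ g p) (h0 : g p ≠ 0) :
    pd d (fun q => f q / g q) p = (pd d f p * g p - f p * pd d g p) / g p ^ 2 := by
  have key := pd_mul (d := d) (f := fun q => f q / g q) (by fun_prop (disch := assumption)) hg
  have hcongr : (fun q => f q / g q * g q) =ᶠ[nhds p] f := by
    filter_upwards [hg.continuousAt.eventually_ne h0] with q hq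
    exact div_mul_cancel₀ _ hq
  rw [pd_congr hcongr] at key
  field_simp
  rw [key]
  field_simp
  ring

lemma pd_coordU : pd d (fun q => q.1) p = d.1 := by
  simp [pd, fderiv_fst]

lemma pd_coordV : pd d (fun q => q.2.1) p = d.2.1 := by
  have h : HasFDerivAt (fun q : Pt N => q.2.1)
      ((ContinuousLinearMap.fst ℝ ℝ (Fin N → ℝ)).comp
        (ContinuousLinearMap.snd ℝ ℝ (ℝ × (Fin N → ℝ)))) p :=
    hasFDerivAt_snd.fst
  simp [pd, h.fderiv]

/-- A function of the observables alone has no derivative along the `U`-`V` plane. -/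
lemma pd_observable_eq_zero {M : (Fin N → ℝ) → ℝ} (hM : Differentiable ℝ M) (hd : d.2.2 = 0) :
    pd d (fun q => M q.2.2) p = 0 := by
  have h : HasFDerivAt (fun q : Pt N => q.2.2)
      ((ContinuousLinearMap.snd ℝ ℝ (Fin N → ℝ)).comp
        (ContinuousLinearMap.snd ℝ ℝ (ℝ × (Fin N → ℝ)))) p :=
    hasFDerivAt_snd.snd
  have hc := (hM p.2.2).hasFDerivAt.comp p h
  change fderiv ℝ (M ∘ fun q : Pt N => q.2.2) p d = 0
  rw [hc.fderiv]
  simp [hd]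

end PartialDerivatives

section Kruskal

variable {N : ℕ} {Ω : Set (Pt N)} {m X : Pt N → ℝ} {p : Pt N}

/-- Implicit differentiation of `(X - 1) e ^ X = -UV`. -/
lemma pd_of_kruskal (hΩ : IsOpen Ω) (hX : DifferentiableOn ℝ X Ω) (hX0 : ∀ q ∈ Ω, X q ≠ 0)
    (hrel : ∀ q ∈ Ω, (X q - 1) * Real.exp (X q) = -(q.1 * q.2.1)) (hp : p ∈ Ω) (d : Pt N) :
    pd d X p = -(d.1 * p.2.1 + p.1 * d.2.1) * Real.exp (-X p) / X p := by
  have hXp := hX.differentiableAt (hΩ.mem_nhds hp)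
  have h0 := hX0 p hp
  have h : pd d (fun q => (X q + -1) * Real.exp (X q)) p = pd d (fun q => -(q.1 * q.2.1)) p :=
    pd_congr (by filter_upwards [hΩ.mem_nhds hp] with q hq using hrel q hq)
  rw [pd_mul (by fun_prop) (by fun_prop), pd_add_const, pd_exp hXp, pd_neg,
    pd_mul (by fun_prop) (by fun_prop), pd_coordU, pd_coordV] at h
  have hE : Real.exp (X p) * Real.exp (-X p) = 1 := by rw [← Real.exp_add]; simp
  rw [eq_div_iff h0]
  linear_combination Real.exp (-X p) * h - X p * pd d X p * hE

/-- Mixed second derivatives of `2 m X`, the first one along the `U`-`V` plane. -/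
lemma pd_pd_radius (hΩ : IsOpen Ω) (hX : DifferentiableOn ℝ X Ω) (hm : Differentiable ℝ m)
    (hX0 : ∀ q ∈ Ω, X q ≠ 0)
    (hrel : ∀ q ∈ Ω, (X q - 1) * Real.exp (X q) = -(q.1 * q.2.1)) (hp : p ∈ Ω)
    {R : Pt N → ℝ} (hR : ∀ q ∈ Ω, R q = 2 * (m q * X q))
    (d e : Pt N) (hd : ∀ q, pd d m q = 0) :
    pd e (pd d R) p = 2 * (pd e m p * pd d X p - m p * Real.exp (-X p) / X p *
      ((d.1 * e.2.1 + e.1 * d.2.1)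
        - (d.1 * p.2.1 + p.1 * d.2.1) * pd e X p * (1 + 1 / X p))) := by
  have hXp := hX.differentiableAt (hΩ.mem_nhds hp)
  have h0 := hX0 p hp
  have h : pd d R =ᶠ[nhds p] fun q => -2 * (m q *
      ((d.1 * q.2.1 + d.2.1 * q.1) * Real.exp (-X q) / X q)) := by
    filter_upwards [hΩ.mem_nhds hp] with q hq
    have hXq := hX.differentiableAt (hΩ.mem_nhds hq)
    have hRq : R =ᶠ[nhds q] fun q => 2 * (m q * X q) := by
      filter_upwards [hΩ.mem_nhds hq] with y hy using hR y hy
    rw [pd_congr hRq, pd_const_mul _ (by fun_prop), pd_mul (by fun_prop) hXq, hd,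
      pd_of_kruskal hΩ hX hX0 hrel hq]
    ring
  have hlin : pd e (fun q : Pt N => d.1 * q.2.1 + d.2.1 * q.1) p
      = d.1 * e.2.1 + d.2.1 * e.1 := by
    have := fderiv_fun_add (𝕜 := ℝ) (x := p) (f := fun q : Pt N => d.1 * q.2.1)
      (g := fun q : Pt N => d.2.1 * q.1) (by fun_prop) (by fun_prop)
    rw [pd, this, add_apply]
    exact congrArg₂ (· + ·)
      ((pd_const_mul _ (by fun_prop)).trans (congrArg _ pd_coordV))
      ((pd_const_mul _ (by fun_prop)).trans (congrArg _ pd_coordU))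
  rw [pd_congr h, pd_const_mul _ (by fun_prop (disch := assumption)),
    pd_mul (by fun_prop) (by fun_prop (disch := assumption)),
    pd_div (by fun_prop) hXp h0, pd_mul (by fun_prop) (by fun_prop), hlin,
    pd_exp (by fun_prop), pd_neg, pd_of_kruskal hΩ hX hX0 hrel hp d]
  field_simp
  ring

end Kruskal

/- STATEMENT 13: For the Schwarzschild data `(A, R)` of mass `M(o)` in Kruskal
coordinates, the functions `F_reg = −(M(R + 2M)/2) e^{−R/(2M)} V`,
`G_reg = (M(R + 2M)/2) e^{−R/(2M)} U` and `H_i = 0` solve system (S) on `Ω`;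
moreover this solution is regular (smooth) on all of `Ω`, including the
horizons `U = 0` and `V = 0`. -/
theorem stmt_13 (N : ℕ)
    (M : (Fin N → ℝ) → ℝ) (hM : ContDiff ℝ (⊤ : ℕ∞) M) (hMpos : ∀ o, 0 < M o)
    (Ω : Set (Pt N)) (hΩ : IsOpen Ω)
    (R : Pt N → ℝ) (hR : ContDiffOn ℝ (⊤ : ℕ∞) R Ω)
    (hRpos : ∀ p ∈ Ω, 0 < R p)
    (hrel : ∀ p ∈ Ω,
      (R p / (2 * M p.2.2) - 1) * Real.exp (R p / (2 * M p.2.2)) = -(p.1 * p.2.1))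
    (A : Pt N → ℝ)
    (hAdef : ∀ p : Pt N,
      A p = 32 * M p.2.2 ^ 3 / R p * Real.exp (-(R p / (2 * M p.2.2))))
    (Freg Greg : Pt N → ℝ) (H : Fin N → Pt N → ℝ)
    (hFdef : ∀ p : Pt N,
      Freg p = -(M p.2.2 * (R p + 2 * M p.2.2) / 2)
        * Real.exp (-(R p / (2 * M p.2.2))) * p.2.1)
    (hGdef : ∀ p : Pt N,
      Greg p = M p.2.2 * (R p + 2 * M p.2.2) / 2
        * Real.exp (-(R p / (2 * M p.2.2))) * p.1)
    (hHdef : ∀ (i : Fin N) (p : Pt N), H i p = 0) :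
    SolvesSOn N Ω A R Freg Greg H ∧
    ContDiffOn ℝ (⊤ : ℕ∞) Freg Ω ∧ ContDiffOn ℝ (⊤ : ℕ∞) Greg Ω ∧
    ∀ i, ContDiffOn ℝ (⊤ : ℕ∞) (H i) Ω := by
  set m : Pt N → ℝ := fun q => M q.2.2
  set X : Pt N → ℝ := fun q => R q / (2 * m q) with hX_def
  have hmpos : ∀ q, 0 < m q := fun q => hMpos _
  have hmC : ContDiff ℝ (⊤ : ℕ∞) m := hM.comp (by fun_prop)
  have hXC : ContDiffOn ℝ (⊤ : ℕ∞) X Ω :=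
    hR.div (contDiff_const.mul hmC).contDiffOn fun q _ => by have := hmpos q; positivity
  have hEC : ContDiffOn ℝ (⊤ : ℕ∞) (fun q => Real.exp (-X q)) Ω := hXC.neg.exp
  have hFC : ContDiffOn ℝ (⊤ : ℕ∞) Freg Ω := by
    rw [funext hFdef]
    exact (((hmC.contDiffOn.mul (hR.add (contDiff_const.mul hmC).contDiffOn)).div_const 2).neg.mul
      hEC).mul (by fun_prop)
  have hGC : ContDiffOn ℝ (⊤ : ℕ∞) Greg Ω := by
    rw [funext hGdef]
    exact (((hmC.contDiffOn.mul (hR.add (contDiff_const.mul hmC).contDiffOn)).div_const 2).mul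
      hEC).mul (by fun_prop)
  have hH : ∀ i, H i = fun _ => 0 := fun i => funext (hHdef i)
  refine ⟨?_, hFC, hGC, fun i => hH i ▸ contDiffOn_const⟩
  intro i p hp
  have hm : Differentiable ℝ m := hmC.differentiable (by simp)
  have hX : DifferentiableOn ℝ X Ω := hXC.differentiableOn (by simp)
  have hXpos : ∀ q ∈ Ω, 0 < X q := fun q hq =>
    div_pos (hRpos q hq) (mul_pos two_pos (hmpos q))
  have hX0 : ∀ q ∈ Ω, X q ≠ 0 := fun q hq => (hXpos q hq).ne'
  have hXp := hX.differentiableAt (hΩ.mem_nhds hp)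
  have hR_eq : ∀ q, R q = 2 * (m q * X q) := fun q => by
    have := (hmpos q).ne'
    simp only [hX_def]
    field_simp
  have hA_eq : A = fun q => 16 * (m q * m q * Real.exp (-X q)) / X q := funext fun q => by
    have := (hmpos q).ne'
    rw [hAdef]
    change 32 * m q ^ 3 / R q * Real.exp (-X q) = _
    rw [hR_eq q]
    field_simp
    ring
  have hF_eq : Freg = fun q => -(m q * m q * (X q + 1) * Real.exp (-X q) * q.2.1) :=
    funext fun q => by
      rw [hFdef]
      change -(m q * (R q + 2 * m q) / 2) * Real.exp (-X q) * q.2.1 = _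
      rw [hR_eq q]
      ring
  have hG_eq : Greg = fun q => m q * m q * (X q + 1) * Real.exp (-X q) * q.1 :=
    funext fun q => by
      rw [hGdef]
      change m q * (R q + 2 * m q) / 2 * Real.exp (-X q) * q.1 = _
      rw [hR_eq q]
      ring
  have hXd := pd_of_kruskal hΩ hX hX0 hrel hp
  have hRR := pd_pd_radius hΩ hX hm hX0 hrel hp fun q _ => hR_eq q
  have hRd (d : Pt N) : pd d R p = 2 * (pd d m p * X p + m p * pd d X p) := by
    rw [funext hR_eq, pd_const_mul _ (by fun_prop), pd_mul (by fun_prop) hXp]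
  have hAd (d : Pt N) : pd d A p = 16 * m p * Real.exp (-X p) / X p *
      (2 * pd d m p - m p * pd d X p * (1 + 1 / X p)) := by
    have h0 := hX0 p hp
    rw [hA_eq, pd_div (by fun_prop) hXp h0, pd_const_mul _ (by fun_prop),
      pd_mul (by fun_prop) (by fun_prop), pd_mul (by fun_prop) (by fun_prop),
      pd_exp (by fun_prop), pd_neg]
    field_simp
    ring
  have hprof (d : Pt N) : pd d (fun q => m q * m q * (X q + 1) * Real.exp (-X q)) p
      = m p * Real.exp (-X p) * (2 * pd d m p * (X p + 1) - m p * X p * pd d X p) := by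
    rw [pd_mul (by fun_prop) (by fun_prop), pd_mul (by fun_prop) (by fun_prop),
      pd_mul (by fun_prop) (by fun_prop), pd_add_const, pd_exp (by fun_prop), pd_neg]
    ring
  have hFd (d : Pt N) : pd d Freg p = -(m p * Real.exp (-X p) *
      (2 * pd d m p * (X p + 1) - m p * X p * pd d X p) * p.2.1
        + m p * m p * (X p + 1) * Real.exp (-X p) * d.2.1) := by
    rw [hF_eq, pd_neg, pd_mul (by fun_prop) (by fun_prop), hprof, pd_coordV]
  have hGd (d : Pt N) : pd d Greg p = m p * Real.exp (-X p) *
      (2 * pd d m p * (X p + 1) - m p * X p * pd d X p) * p.1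
        + m p * m p * (X p + 1) * Real.exp (-X p) * d.1 := by
    rw [hG_eq, pd_mul (by fun_prop) (by fun_prop), hprof, pd_coordU]
  have hHd (d : Pt N) : pd d (H i) p = 0 := by simp [hH, pd]
  have hmU (q : Pt N) : pd (dU N) m q = 0 :=
    pd_observable_eq_zero (hM.differentiable (by simp)) rfl
  have hmV (q : Pt N) : pd (dV N) m q = 0 :=
    pd_observable_eq_zero (hM.differentiable (by simp)) rfl
  have hAp : A p = 16 * (m p * m p * Real.exp (-X p)) / X p := congrFun hA_eq p
  rw [hRR (dV N) (dU N) hmV, hRR (dU N) (dO N i) hmU, hRR (dV N) (dO N i) hmV]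
  simp only [hFd, hGd, hHd, hAd, hRd, hXd, hmU, hmV, hAp, hR_eq p]
  have hrelp : (X p - 1) * Real.exp (X p) = -(p.1 * p.2.1) := hrel p hp
  have hx0 := hX0 p hp
  have hm0 := (hmpos p).ne'
  clear_value X m
  have hE : Real.exp (X p) * Real.exp (-X p) = 1 := by rw [← Real.exp_add]; simp
  have hUV : p.1 * p.2.1 * Real.exp (-X p) = 1 - X p := by
    linear_combination Real.exp (-X p) * hrelp - (X p - 1) * hE
  have hE0 := (Real.exp_pos (-X p)).ne'
  generalize Real.exp (-X p) = E at *
  simp only [dU, dV, dO]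
  refine ⟨?_, ?_, ?_⟩
  · field_simp
    linear_combination -2 * m p ^ 2 * E * X p ^ 2 * hUV
  · field_simp
    ring
  · field_simp
    ring
end
end

section
/- Let M > 0 and let U, V, R be real numbers with R > 0 satisfying the Kruskal relation (R/(2M) − 1) · exp(R/(2M)) = −UV. Then: (i) if U ≠ 0, (R² − 4M²)/(4U) = −(M(R + 2M)/2) · exp(−R/(2M)) · V; and (ii) if V ≠ 0, −(R² − 4M²)/(4V) = (M(R + 2M)/2) · exp(−R/(2M)) · U. Equivalently, subtracting the gradient of W = −M² ln(−U/V) from the singular solution F = R²/(4U), G = −R²/(4V) produces the functions F_reg = −(M(R+2M)/2)e^{−R/2M}V and G_reg = (M(R+2M)/2)e^{−R/2M}U, which are regular at the horizons U = 0 and V = 0. -/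
/-- The Kruskal relation, solved for `R² − 4M²`. -/
theorem sq_sub_four_mul_sq_of_kruskal {M U V R : ℝ} (hM : M ≠ 0)
    (hrel : (R / (2 * M) - 1) * Real.exp (R / (2 * M)) = -(U * V)) :
    R ^ 2 - 4 * M ^ 2 = -(2 * M * (R + 2 * M) * Real.exp (-(R / (2 * M))) * (U * V)) := by
  have hexp : Real.exp (R / (2 * M)) * Real.exp (-(R / (2 * M))) = 1 := by
    rw [← Real.exp_add, add_neg_cancel, Real.exp_zero]
  have hR : R = 2 * M * (R / (2 * M)) := by field_simp
  generalize R / (2 * M) = x at *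
  subst hR
  linear_combination
    (2 * M * (2 * M * x + 2 * M) * Real.exp (-x)) * hrel
      - 4 * M ^ 2 * (x ^ 2 - 1) * hexp

/- STATEMENT 14: Algebraic identities behind the regularization of the
Kruskal-gauge solution: if `(R/(2M) − 1) e^{R/(2M)} = −UV` with `M > 0`,
`R > 0`, then subtracting the gradient of `W = −M² ln(−U/V)` from the singular
solution `F = R²/(4U)`, `G = −R²/(4V)` yields
`F_reg = −(M(R + 2M)/2) e^{−R/(2M)} V` and
`G_reg = (M(R + 2M)/2) e^{−R/(2M)} U`, i.e.
(i) for `U ≠ 0`, `(R² − 4M²)/(4U) = −(M(R + 2M)/2) e^{−R/(2M)} V`, and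
(ii) for `V ≠ 0`, `−(R² − 4M²)/(4V) = (M(R + 2M)/2) e^{−R/(2M)} U`;
the right-hand sides are regular at the horizons `U = 0` and `V = 0`. -/
theorem stmt_14 (M U V R : ℝ) (hM : 0 < M) (hR : 0 < R)
    (hrel : (R / (2 * M) - 1) * Real.exp (R / (2 * M)) = -(U * V)) :
    (U ≠ 0 →
      (R ^ 2 - 4 * M ^ 2) / (4 * U)
        = -(M * (R + 2 * M) / 2) * Real.exp (-(R / (2 * M))) * V) ∧
    (V ≠ 0 →
      -((R ^ 2 - 4 * M ^ 2) / (4 * V))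
        = M * (R + 2 * M) / 2 * Real.exp (-(R / (2 * M))) * U) := by
  have h := sq_sub_four_mul_sq_of_kruskal hM.ne' hrel
  refine ⟨fun hU => ?_, fun hV => ?_⟩
  · rw [div_eq_iff (mul_ne_zero four_ne_zero hU)]
    linear_combination h
  · rw [← neg_div, div_eq_iff (mul_ne_zero four_ne_zero hV)]
    linear_combination -h
end
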